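/- arXiv:math/0109150 — 5 statements merged into one kernel-verified Lean document; each statement's English description precedes it below -/
import Mathlib

section
/- For every integer g ≥ 2, the surface group Γ_g contains no nontrivial normal cyclic subgroup: if v ∈ Γ_g is such that the cyclic subgroup {v^n : n ∈ ℤ} is normal in Γ_g, then v = 1. -/
open scoped commutatorElement

/-- The surface relator `[a_1,b_1]⋯[a_g,b_g]` in the free group on `a_1,b_1,…,a_g,b_g`. -/
def surfaceRel (g : ℕ) : FreeGroup (Fin g ⊕ Fin g) :=
  (List.ofFn fun i : Fin g => ⁅(FreeGroup.of (Sum.inl i) : FreeGroup (Fin g ⊕ Fin g)), FreeGroup.of (Sum.inr i)⁆).prod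

/-- The surface group `Γ_g`, i.e. the fundamental group of the closed orientable surface of
genus `g`. -/
abbrev SurfaceGroup (g : ℕ) := PresentedGroup ({surfaceRel g} : Set (FreeGroup (Fin g ⊕ Fin g)))

namespace SurfAux

/-- product of commutators -/
def cw {G : Type*} [Group G] {m : ℕ} (p q : Fin m → G) : G :=
  (List.ofFn fun s => ⁅p s, q s⁆).prod

lemma map_cw {G H : Type*} [Group G] [Group H] {m : ℕ} (p q : Fin m → G) (f : G →* H) :
    f (cw p q) = cw (fun s => f (p s)) (fun s => f (q s)) := by
  simp [cw, map_list_prod, List.map_ofFn, Function.comp_def, map_commutatorElement]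

abbrev X (m : ℕ) := Option ((Fin m ⊕ Fin m) × ℤ)
abbrev F (m : ℕ) := FreeGroup (X m)

def x {m : ℕ} (j : Fin m ⊕ Fin m) (i : ℤ) : F m := FreeGroup.of (some (j, i))
def a {m : ℕ} : F m := FreeGroup.of none
def W (m : ℕ) (i : ℤ) : F m := cw (fun s => x (Sum.inl s) i) (fun s => x (Sum.inr s) i)

def phi0 (m : ℕ) (k : ℤ) (u : F m) : F m →* F m :=
  FreeGroup.lift fun o => o.elim (u * a) (fun p => x p.1 (p.2 + k))

@[simp] lemma phi0_x {m : ℕ} (k : ℤ) (u : F m) (j) (i : ℤ) : phi0 m k u (x j i) = x j (i + k) := by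
  simp [phi0, x]
@[simp] lemma phi0_a {m : ℕ} (k : ℤ) (u : F m) : phi0 m k u a = u * a := by
  simp [phi0, a]
@[simp] lemma phi0_W {m : ℕ} (k : ℤ) (u : F m) (i : ℤ) : phi0 m k u (W m i) = W m (i + k) := by
  simp [W, map_cw]

lemma hom_ext' {m : ℕ} {H : Type*} [Group H] {f g : F m →* H} (ha : f a = g a)
    (hx : ∀ j i, f (x j i) = g (x j i)) : f = g := by
  ext o
  rcases o with _ | ⟨j, i⟩
  · exact ha
  · exact hx j i

def phi (m : ℕ) : MulAut (F m) :=
  MonoidHom.toMulEquiv (phi0 m 1 (W m 0)) (phi0 m (-1) (W m (-1))⁻¹)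
    (hom_ext' (by simp) (by simp)) (hom_ext' (by simp) (by simp))

@[simp] lemma phi_x {m : ℕ} (j) (i : ℤ) : phi m (x j i) = x j (i + 1) := phi0_x 1 (W m 0) j i
@[simp] lemma phi_a {m : ℕ} : phi m a = W m 0 * a := phi0_a 1 (W m 0)

lemma phi_zpow_x {m : ℕ} (n : ℤ) (j) (i : ℤ) : (phi m ^ n) (x j i) = x j (i + n) := by
  induction n using Int.induction_on generalizing i with
  | zero => simp
  | succ n ih => rw [zpow_add_one, MulAut.mul_apply, phi_x, ih]; congr 1; ring
  | pred n ih =>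
    rw [zpow_sub_one, MulAut.mul_apply]
    have : (phi m)⁻¹ (x j i) = x j (i - 1) := by
      rw [MulAut.inv_apply, MulEquiv.symm_apply_eq, phi_x, sub_add_cancel]
    rw [this, ih]; congr 1; ring

abbrev S (m : ℕ) := F m ⋊[zpowersHom (MulAut (F m)) (phi m)] Multiplicative ℤ

def t (m : ℕ) : S m := SemidirectProduct.inr (Multiplicative.ofAdd 1)

lemma t_conj {m : ℕ} (f : F m) :
    t m * SemidirectProduct.inl f * (t m)⁻¹ = SemidirectProduct.inl (phi m f) := by
  have := SemidirectProduct.inl_aut (φ := zpowersHom (MulAut (F m)) (phi m))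
    (Multiplicative.ofAdd 1) f
  simp only [zpowersHom_apply, toAdd_ofAdd, zpow_one, map_inv] at this
  exact this.symm

lemma t_zpow {m : ℕ} (n : ℤ) : t m ^ n = SemidirectProduct.inr (Multiplicative.ofAdd n) := by
  rw [t, ← map_zpow, ← ofAdd_zsmul]; simp

lemma t_conj_zpow_x {m : ℕ} (n : ℤ) (j) :
    t m ^ n * SemidirectProduct.inl (x j 0) * (t m ^ n)⁻¹ = SemidirectProduct.inl (x j n) := by
  have := SemidirectProduct.inl_aut (φ := zpowersHom (MulAut (F m)) (phi m))
    (Multiplicative.ofAdd n) (x j 0)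
  simp only [zpowersHom_apply, toAdd_ofAdd, map_inv, phi_zpow_x, zero_add] at this
  rw [t_zpow]
  exact this.symm

/-- images of generators -/
def gen (m : ℕ) : Fin (m + 1) ⊕ Fin (m + 1) → S m
  | Sum.inl i => Fin.cases (SemidirectProduct.inl a) (fun s => SemidirectProduct.inl (x (Sum.inl s) 0)) i
  | Sum.inr i => Fin.cases (t m) (fun s => SemidirectProduct.inl (x (Sum.inr s) 0)) i

lemma rel_eq (m : ℕ) {G : Type*} [Group G] (f : FreeGroup (Fin (m + 1) ⊕ Fin (m + 1)) →* G) :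
    f (surfaceRel (m + 1)) = ⁅f (FreeGroup.of (Sum.inl 0)), f (FreeGroup.of (Sum.inr 0))⁆ *
      cw (fun s : Fin m => f (FreeGroup.of (Sum.inl s.succ)))
        (fun s : Fin m => f (FreeGroup.of (Sum.inr s.succ))) := by
  simp [surfaceRel, cw, map_list_prod, List.map_ofFn, Function.comp_def, map_commutatorElement, List.ofFn_succ]

lemma gen_rel (m : ℕ) : ∀ r ∈ ({surfaceRel (m + 1)} : Set _), FreeGroup.lift (gen m) r = 1 := by
  rintro r rfl
  rw [rel_eq]
  simp only [FreeGroup.lift_apply_of, gen, Fin.cases_zero, Fin.cases_succ]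
  rw [← map_cw]
  change _ * SemidirectProduct.inl (W m 0) = 1
  have h := t_conj (m := m) a
  rw [phi_a, map_mul] at h
  have h2 : (SemidirectProduct.inl (W m 0) : S m) =
    t m * SemidirectProduct.inl a * (t m)⁻¹ * (SemidirectProduct.inl a)⁻¹ := by rw [h]; group
  rw [h2, commutatorElement_def]; group

def toS (m : ℕ) : SurfaceGroup (m + 1) →* S m := PresentedGroup.toGroup (gen_rel m)

abbrev ga (m : ℕ) (i : Fin (m + 1)) : SurfaceGroup (m + 1) := PresentedGroup.of (Sum.inl i)
abbrev gb (m : ℕ) (i : Fin (m + 1)) : SurfaceGroup (m + 1) := PresentedGroup.of (Sum.inr i)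

def gx (m : ℕ) (j : Fin m ⊕ Fin m) : SurfaceGroup (m + 1) :=
  j.elim (fun s => ga m s.succ) (fun s => gb m s.succ)

lemma surf_rel (m : ℕ) : ⁅ga m 0, gb m 0⁆ *
    cw (fun s : Fin m => ga m s.succ) (fun s : Fin m => gb m s.succ) = 1 := by
  have := rel_eq m (PresentedGroup.mk ({surfaceRel (m + 1)} : Set _))
  rw [PresentedGroup.one_of_mem (Set.mem_singleton _)] at this
  exact this.symm

def fn (m : ℕ) : F m →* SurfaceGroup (m + 1) :=
  FreeGroup.lift fun o => o.elim (ga m 0) (fun p => gb m 0 ^ p.2 * gx m p.1 * (gb m 0 ^ p.2)⁻¹)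

lemma fn_a (m : ℕ) : fn m a = ga m 0 := by simp [fn, a]
lemma fn_x (m : ℕ) (j i) : fn m (x j i) = gb m 0 ^ i * gx m j * (gb m 0 ^ i)⁻¹ := by
  simp [fn, x]

lemma fn_phi (m : ℕ) (f : F m) : fn m (phi m f) = gb m 0 * fn m f * (gb m 0)⁻¹ := by
  have : (fn m).comp (phi m).toMonoidHom = (MulAut.conj (gb m 0)).toMonoidHom.comp (fn m) := by
    apply hom_ext'
    · simp only [MonoidHom.comp_apply, MulEquiv.coe_toMonoidHom, phi_a, MulAut.conj_apply, map_mul,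
        fn_a, W, map_cw, fn_x, zpow_zero, one_mul, inv_one, mul_one, gx, Sum.elim_inl, Sum.elim_inr]
      have h := surf_rel m
      rw [mul_eq_one_iff_inv_eq] at h
      rw [← h, commutatorElement_def]; group
    · intro j i
      simp only [MonoidHom.comp_apply, MulEquiv.coe_toMonoidHom, phi_x, MulAut.conj_apply, fn_x]
      group
  exact DFunLike.congr_fun this f

lemma fn_phi_zpow (m : ℕ) (n : ℤ) (f : F m) :
    fn m ((phi m ^ n) f) = gb m 0 ^ n * fn m f * (gb m 0 ^ n)⁻¹ := by
  induction n using Int.induction_on generalizing f with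
  | zero => simp
  | succ n ih => rw [zpow_add_one, MulAut.mul_apply, ih, fn_phi]; group
  | pred n ih =>
    rw [zpow_sub_one, MulAut.mul_apply, ih]
    have h := fn_phi m ((phi m)⁻¹ f)
    rw [MulAut.apply_inv_self] at h
    rw [h]; group

def back (m : ℕ) : S m →* SurfaceGroup (m + 1) :=
  SemidirectProduct.lift (fn m) (zpowersHom _ (gb m 0)) (by
    intro n
    ext1 o
    simp only [MonoidHom.comp_apply, MulEquiv.coe_toMonoidHom, zpowersHom_apply, MulAut.conj_apply,
      fn_phi_zpow])

lemma back_toS (m : ℕ) (v) : back m (toS m v) = v := by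
  have : (back m).comp (toS m) = MonoidHom.id _ := by
    apply PresentedGroup.ext
    rintro (i | i) <;> induction i using Fin.cases <;>
      simp [toS, gen, back, t, fn_a, fn_x, gx]
  exact DFunLike.congr_fun this v

lemma x_range (m : ℕ) (j i) : ∃ u, toS m u = SemidirectProduct.inl (x j i) := by
  refine ⟨gb m 0 ^ i * gx m j * (gb m 0 ^ i)⁻¹, ?_⟩
  rw [map_mul, map_mul, map_inv, map_zpow, ← t_conj_zpow_x]
  have h1 : toS m (gb m 0) = t m := by simp [toS, gen]
  have h2 : toS m (gx m j) = SemidirectProduct.inl (x j 0) := by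
    rcases j with s | s <;> simp [toS, gen, gx]
  rw [h1, h2]

/-- an element of the free group commuting with a generator not occurring in it is trivial -/
lemma free_comm {A : Type*} [DecidableEq A] (c : A) (f : FreeGroup A)
    (hc : ∀ p ∈ f.toWord, p.1 ≠ c) (h : FreeGroup.of c * f = f * FreeGroup.of c) : f = 1 := by
  rw [← FreeGroup.toWord_eq_nil_iff]
  have hr := FreeGroup.isReduced_toWord (x := f)
  have e : FreeGroup.mk ((c, true) :: f.toWord) = FreeGroup.mk (f.toWord ++ [(c, true)]) := by
    have h1 : FreeGroup.mk [(c, true)] = FreeGroup.of c := rfl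
    have := h
    rw [← FreeGroup.mk_toWord (x := f), ← h1, FreeGroup.mul_mk, FreeGroup.mul_mk] at this
    exact this
  have r1 : FreeGroup.IsReduced ((c, true) :: f.toWord) := by
    unfold FreeGroup.IsReduced at *
    rw [List.isChain_cons]
    refine ⟨fun y hy hcy => absurd hcy.symm (hc y (List.mem_of_mem_head? hy)), hr⟩
  have r2 : FreeGroup.IsReduced (f.toWord ++ [(c, true)]) := by
    unfold FreeGroup.IsReduced at *
    rw [List.isChain_append]
    refine ⟨hr, by simp, fun y hy z hz hyz => ?_⟩
    simp at hz
    subst hz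
    exact absurd hyz (hc y (List.mem_of_mem_getLast? hy))
  have e2 := congrArg FreeGroup.toWord e
  rw [FreeGroup.toWord_mk, FreeGroup.toWord_mk, r1.reduce_eq, r2.reduce_eq] at e2
  by_contra hne
  obtain ⟨p, l, hl⟩ := List.exists_cons_of_ne_nil hne
  rw [hl] at e2 hc
  simp at e2
  exact hc p (by simp) (by rw [← e2.1])

lemma free_norm {A : Type*} [DecidableEq A] (c : A) (f : FreeGroup A) (k : ℤ)
    (hc : ∀ p ∈ f.toWord, p.1 ≠ c) (h : FreeGroup.of c * f * (FreeGroup.of c)⁻¹ = f ^ k) :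
    f = 1 := by
  let r : FreeGroup A →* FreeGroup A :=
    FreeGroup.lift fun y => if y = c then 1 else FreeGroup.of y
  have hrc : r (FreeGroup.of c) = 1 := by simp [r]
  have key : ∀ L : List (A × Bool), (∀ p ∈ L, p.1 ≠ c) → r (FreeGroup.mk L) = FreeGroup.mk L := by
    intro L
    induction L with
    | nil => intro _; exact map_one r
    | cons p L ih =>
      intro hL
      have e : FreeGroup.mk (p :: L) = FreeGroup.mk [p] * FreeGroup.mk L := by
        rw [FreeGroup.mul_mk]; rfl
      rw [e, map_mul, ih (fun q hq => hL q (by simp [hq]))]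
      congr 1
      have hp := hL p (by simp)
      obtain ⟨y, b⟩ := p
      cases b
      · have : FreeGroup.mk [(y, false)] = (FreeGroup.of y)⁻¹ := rfl
        rw [this, map_inv]; simp [r]; intro h; exact absurd h hp
      · have : FreeGroup.mk [(y, true)] = FreeGroup.of y := rfl
        rw [this]; simp [r]; intro h; exact absurd h hp
  have hrf : r f = f := by
    have := key f.toWord hc
    rwa [FreeGroup.mk_toWord] at this
  have h2 := congrArg r h
  rw [map_mul, map_mul, map_inv, hrc, map_zpow, hrf] at h2
  simp only [one_mul, inv_one, mul_one] at h2
  rw [← h2] at h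
  exact free_comm c f hc (mul_inv_eq_iff_eq_mul.mp h)

lemma exists_fresh {m : ℕ} (j : Fin m ⊕ Fin m) (L : List (X m × Bool)) :
    ∃ i : ℤ, ∀ p ∈ L, p.1 ≠ some (j, i) := by
  classical
  have hinj : Function.Injective (fun i : ℤ => (some (j, i) : X m)) := by
    intro i i' h; simpa using h
  obtain ⟨y, ⟨i, rfl⟩, hy⟩ := (Set.infinite_range_of_injective hinj).exists_notMem_finset
    (L.map Prod.fst).toFinset
  refine ⟨i, fun p hp h => hy ?_⟩
  rw [List.mem_toFinset, List.mem_map]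
  exact ⟨p, hp, h⟩

lemma main (m : ℕ) (hm : 1 ≤ m) (w : S m)
    (hw : ∀ j i, ∃ k : ℤ, w ^ k = SemidirectProduct.inl (x j i) * w *
      (SemidirectProduct.inl (x j i))⁻¹) : w = 1 := by
  classical
  let j : Fin m ⊕ Fin m := Sum.inl ⟨0, hm⟩
  by_cases hn : w.right = 1
  · obtain ⟨f, rfl⟩ : ∃ f, w = SemidirectProduct.inl f := ⟨w.left, by ext <;> simp [hn]⟩
    obtain ⟨i, hi⟩ := exists_fresh j f.toWord
    obtain ⟨k, hk⟩ := hw j i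
    rw [← map_zpow, ← map_inv, ← map_mul, ← map_mul, SemidirectProduct.inl_inj] at hk
    rw [free_norm _ f k hi hk.symm, map_one]
  · exfalso
    obtain ⟨k, hk⟩ := hw j 0
    have h1 := congrArg SemidirectProduct.rightHom hk
    simp only [map_mul, map_zpow, map_inv, SemidirectProduct.rightHom_inl, one_mul, inv_one,
      mul_one, SemidirectProduct.rightHom_eq_right] at h1
    have h2 : k = 1 := by
      have h3 := congrArg Multiplicative.toAdd h1
      rw [toAdd_zpow, smul_eq_mul] at h3
      have : Multiplicative.toAdd w.right ≠ 0 := by simpa using hn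
      exact mul_right_cancel₀ this (by rw [h3, one_mul])
    rw [h2, zpow_one, eq_mul_inv_iff_mul_eq] at hk
    have h4 := congrArg SemidirectProduct.left hk
    rw [SemidirectProduct.mul_left, SemidirectProduct.mul_left] at h4
    simp only [SemidirectProduct.left_inl, SemidirectProduct.right_inl, zpowersHom_apply,
      phi_zpow_x, map_one, MulAut.one_apply, zero_add] at h4
    let c : F m →* Multiplicative ℤ :=
      FreeGroup.lift fun o => if o = some (j, 0) then Multiplicative.ofAdd 1 else 1
    have h5 := congrArg c h4
    rw [map_mul, map_mul, mul_comm] at h5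
    have h6 := mul_right_cancel h5
    have hn' : Multiplicative.toAdd w.right ≠ 0 := by simpa using hn
    simp [c, x, hn] at h6
    exact absurd (congrArg Multiplicative.toAdd h6) (by decide)

end SurfAux

/-- For every integer `g ≥ 2`, the surface group `Γ_g` contains no nontrivial
normal cyclic subgroup: if the cyclic subgroup generated by `v ∈ Γ_g` is normal, then `v = 1`. -/
theorem surfaceGroup_no_normal_cyclic (g : ℕ) (hg : 2 ≤ g) (v : SurfaceGroup g)
    (hv : (Subgroup.zpowers v).Normal) : v = 1 := by
  obtain ⟨m, rfl⟩ : ∃ m, g = m + 1 := ⟨g - 1, by omega⟩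
  have h : SurfAux.toS m v = 1 := by
    apply SurfAux.main m (by omega)
    intro j i
    obtain ⟨u, hu⟩ := SurfAux.x_range m j i
    obtain ⟨k, hk⟩ := Subgroup.mem_zpowers_iff.mp
      (hv.conj_mem v (Subgroup.mem_zpowers v) u)
    refine ⟨k, ?_⟩
    rw [← hu, ← map_zpow, hk, map_mul, map_mul, map_inv]
  rw [← SurfAux.back_toS m v, h, map_one]
end

section
/- Let H and Q be groups such that the center of Q is trivial, and let φ : ℤ × H → Q be a surjective group homomorphism whose kernel K is isomorphic to ℤ × ℤ. Then the subgroup ℤ × {1} is contained in K, and there exists a normal subgroup N of H with N isomorphic to ℤ and the quotient H/N isomorphic to Q. -/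
theorem aux_add {A : Type} [AddCommGroup A] (e0 : (ℤ × A) ≃+ (ℤ × ℤ)) : Nonempty (A ≃+ ℤ) := by
  let e : (ℤ × A) ≃ₗ[ℤ] (ℤ × ℤ) := e0.toIntLinearEquiv
  have hfin : Module.Finite ℤ A :=
    Module.Finite.of_surjective ((LinearMap.snd ℤ ℤ A).comp e.symm.toLinearMap)
      (Prod.snd_surjective.comp e.symm.surjective)
  have hinj : Function.Injective (e.toLinearMap.comp (LinearMap.inr ℤ ℤ A)) :=
    e.injective.comp (LinearMap.inr_injective (R := ℤ))
  have hfree : Module.Free ℤ A :=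
    Module.Free.of_equiv (LinearEquiv.ofInjective _ hinj).symm
  have h := e.finrank_eq
  rw [Module.finrank_prod, Module.finrank_prod, Module.finrank_self] at h
  have h1 : Module.finrank ℤ A = Module.finrank ℤ ℤ := by
    rw [Module.finrank_self]; omega
  exact ⟨(LinearEquiv.ofFinrankEq A ℤ h1).toAddEquiv⟩

theorem aux_mul {A : Type} [Group A] (e : (Multiplicative ℤ × A) ≃* Multiplicative (ℤ × ℤ)) :
    Nonempty (A ≃* Multiplicative ℤ) := by
  have hc : ∀ a b : A, a * b = b * a := by
    intro a b
    have h : ((1 : Multiplicative ℤ), a) * (1, b) = (1, b) * (1, a) := by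
      apply e.injective
      rw [map_mul, map_mul, mul_comm]
    exact congrArg Prod.snd h
  letI : CommGroup A := { (inferInstance : Group A) with mul_comm := hc }
  let e0 : (ℤ × Additive A) ≃+ (ℤ × ℤ) :=
    { toFun := fun x => (e (Multiplicative.ofAdd x.1, x.2.toMul)).toAdd
      invFun := fun y => ((e.symm (Multiplicative.ofAdd y)).1.toAdd,
        Additive.ofMul (e.symm (Multiplicative.ofAdd y)).2)
      left_inv := fun x => by simp
      right_inv := fun y => by simp
      map_add' := fun x y => by
        rw [← toAdd_mul, ← map_mul]; rfl }
  obtain ⟨f⟩ := aux_add e0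
  exact ⟨AddEquiv.toMultiplicativeRight f⟩

/-- Let `H` and `Q` be groups such that the center of `Q` is trivial, and let
`φ : ℤ × H → Q` be a surjective group homomorphism whose kernel `K` is isomorphic to `ℤ × ℤ`.
Then the subgroup `ℤ × {1}` is contained in `K`, and there exists a normal subgroup `N` of `H`
with `N` isomorphic to `ℤ` and the quotient `H/N` isomorphic to `Q`. -/
theorem exists_infinite_cyclic_normal_of_surjective_centerless
    {H Q : Type} [Group H] [Group Q] (hQ : Subgroup.center Q = ⊥)
    (φ : Multiplicative ℤ × H →* Q) (hsurj : Function.Surjective φ)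
    (hker : Nonempty (φ.ker ≃* Multiplicative (ℤ × ℤ))) :
    Subgroup.prod (⊤ : Subgroup (Multiplicative ℤ)) (⊥ : Subgroup H) ≤ φ.ker ∧
    ∃ (N : Subgroup H) (hN : N.Normal),
      Nonempty (N ≃* Multiplicative ℤ) ∧
      Nonempty (letI := hN; ((H ⧸ N) ≃* Q)) := by
  have hc : ∀ z : Multiplicative ℤ, φ (z, 1) = 1 := by
    intro z
    have : φ (z, 1) ∈ Subgroup.center Q := by
      rw [Subgroup.mem_center_iff]
      intro q
      obtain ⟨⟨w, h⟩, rfl⟩ := hsurj q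
      rw [← map_mul, ← map_mul, Prod.mk_mul_mk, Prod.mk_mul_mk, mul_comm w z, mul_one, one_mul]
    rwa [hQ, Subgroup.mem_bot] at this
  have hsplit : ∀ z h, φ (z, h) = φ (1, h) := by
    intro z h
    have : ((z, h) : Multiplicative ℤ × H) = (z, 1) * (1, h) := by simp
    rw [this, map_mul, hc, one_mul]
  refine ⟨?_, ?_⟩
  · rintro ⟨z, h⟩ hz
    rw [Subgroup.mem_prod] at hz
    have h1 : h = 1 := by simpa using hz.2
    subst h1
    exact hc z
  · let ψ : H →* Q := φ.comp (MonoidHom.inr (Multiplicative ℤ) H)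
    have hψ : Function.Surjective ψ := by
      intro q
      obtain ⟨⟨w, h⟩, rfl⟩ := hsurj q
      exact ⟨h, (hsplit w h).symm⟩
    refine ⟨ψ.ker, inferInstance, ?_, ⟨QuotientGroup.quotientKerEquivOfSurjective ψ hψ⟩⟩
    obtain ⟨e⟩ := hker
    let g : (Multiplicative ℤ × ψ.ker) ≃* φ.ker :=
      { toFun := fun x => ⟨(x.1, x.2.1), (hsplit _ _).trans x.2.2⟩
        invFun := fun y => (y.1.1, ⟨y.1.2, (hsplit y.1.1 y.1.2).symm.trans y.2⟩)
        left_inv := fun x => rfl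
        right_inv := fun y => rfl
        map_mul' := fun x y => rfl }
    exact aux_mul (g.trans e)
end

section
/- For every integer g ≥ 1 and every integer k, the generator α has infinite order in the circle-bundle group G_{g,k}. (This is the statement that the cyclic subgroup of the fundamental group of a Seifert fibered space generated by a regular fiber is infinite when the base surface has genus at least 1.) -/
open scoped commutatorElement

/-- Generators of the circle-bundle group `G_{g,k}`: `a_i`, `b_i` (for `i < g`) and `α`. -/
abbrev CircleGen (g : ℕ) := (Fin g ⊕ Fin g) ⊕ Unit

/-- The generator `a_i` as an element of the free group. -/
def aGen (g : ℕ) (i : Fin g) : FreeGroup (CircleGen g) := FreeGroup.of (Sum.inl (Sum.inl i))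

/-- The generator `b_i` as an element of the free group. -/
def bGen (g : ℕ) (i : Fin g) : FreeGroup (CircleGen g) := FreeGroup.of (Sum.inl (Sum.inr i))

/-- The generator `α` as an element of the free group. -/
def alphaGen (g : ℕ) : FreeGroup (CircleGen g) := FreeGroup.of (Sum.inr ())

/-- Relators of `G_{g,k}`: the commutators `⁅a_i, α⁆`, `⁅b_i, α⁆` and the relator
`([a_1,b_1]⋯[a_g,b_g])·α^(-k)`. -/
def circleRels (g : ℕ) (k : ℤ) : Set (FreeGroup (CircleGen g)) :=
  {r | (∃ i : Fin g, r = ⁅aGen g i, alphaGen g⁆) ∨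
       (∃ i : Fin g, r = ⁅bGen g i, alphaGen g⁆) ∨
       r = (List.ofFn fun i : Fin g => ⁅aGen g i, bGen g i⁆).prod * (alphaGen g) ^ (-k)}

/-- The circle-bundle group `G_{g,k}`, i.e. the fundamental group of the orientable circle
bundle of Euler number `k` over the closed orientable surface of genus `g`. -/
abbrev CircleBundleGroup (g : ℕ) (k : ℤ) := PresentedGroup (circleRels g k)

/-- The image of the generator `α` in `G_{g,k}`. -/
def alphaElt (g : ℕ) (k : ℤ) : CircleBundleGroup g k := PresentedGroup.of (Sum.inr ())

/-- vertical shift by `n` -/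
def hShift (n : ℤ) : Equiv.Perm (ℤ × ℤ) where
  toFun p := (p.1, p.2 + n)
  invFun p := (p.1, p.2 - n)
  left_inv p := by simp
  right_inv p := by simp

/-- shear -/
def hShear (k : ℤ) : Equiv.Perm (ℤ × ℤ) where
  toFun p := (p.1, p.2 + k * p.1)
  invFun p := (p.1, p.2 - k * p.1)
  left_inv p := by simp
  right_inv p := by simp

/-- horizontal translation -/
def hTrans : Equiv.Perm (ℤ × ℤ) where
  toFun p := (p.1 + 1, p.2)
  invFun p := (p.1 - 1, p.2)
  left_inv p := by simp
  right_inv p := by simp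

theorem hShift_npow (n : ℕ) : hShift 1 ^ n = hShift n := by
  induction n with
  | zero => ext p <;> simp [hShift]
  | succ n ih =>
    rw [pow_succ, ih]
    ext p <;> simp [hShift]
    ring

theorem hShift_inv (n : ℤ) : (hShift n)⁻¹ = hShift (-n) := by
  rw [inv_eq_iff_mul_eq_one]
  ext p <;> simp [hShift]

theorem hShift_zpow (n : ℤ) : hShift 1 ^ n = hShift n := by
  obtain ⟨m, rfl | rfl⟩ := n.eq_nat_or_neg
  · rw [zpow_natCast, hShift_npow]
  · rw [zpow_neg, zpow_natCast, hShift_npow, hShift_inv]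

theorem hShear_comm (k n : ℤ) : hShear k * hShift n = hShift n * hShear k := by
  ext p <;> simp [hShift, hShear]
  ring

theorem hTrans_comm (n : ℤ) : hTrans * hShift n = hShift n * hTrans := by
  ext p <;> simp [hShift, hTrans]

theorem hShear_hTrans (k : ℤ) : ⁅hShear k, hTrans⁆ = hShift k := by
  rw [commutatorElement_def, mul_inv_eq_iff_eq_mul, mul_inv_eq_iff_eq_mul]
  ext p <;> simp [hShift, hShear, hTrans]
  ring

/-- images of the generators -/
def hGen (g : ℕ) (k : ℤ) : CircleGen g → Equiv.Perm (ℤ × ℤ)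
  | Sum.inl (Sum.inl i) => if i.val = 0 then hShear k else 1
  | Sum.inl (Sum.inr i) => if i.val = 0 then hTrans else 1
  | Sum.inr _ => hShift 1

theorem hGen_rels (g : ℕ) (hg : 1 ≤ g) (k : ℤ) :
    ∀ r ∈ circleRels g k, FreeGroup.lift (hGen g k) r = 1 := by
  rintro r (⟨i, rfl⟩ | ⟨i, rfl⟩ | rfl)
  · rw [map_commutatorElement, commutatorElement_eq_one_iff_mul_comm]
    simp only [aGen, alphaGen, FreeGroup.lift_apply_of, hGen]
    split_ifs
    · exact hShear_comm _ _
    · simp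
  · rw [map_commutatorElement, commutatorElement_eq_one_iff_mul_comm]
    simp only [bGen, alphaGen, FreeGroup.lift_apply_of, hGen]
    split_ifs
    · exact hTrans_comm _
    · simp
  · obtain ⟨m, rfl⟩ : ∃ m, g = m + 1 := ⟨g - 1, by omega⟩
    rw [map_mul, map_zpow, map_list_prod, List.map_ofFn, List.ofFn_succ, List.prod_cons]
    have h : (List.ofFn fun i : Fin m => ((FreeGroup.lift (hGen (m+1) k)) ∘
        fun i : Fin (m+1) => ⁅aGen (m+1) i, bGen (m+1) i⁆) i.succ).prod = 1 := by
      apply List.prod_eq_one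
      intro x hx
      rw [List.mem_ofFn] at hx
      obtain ⟨i, rfl⟩ := hx
      simp [map_commutatorElement, aGen, bGen, hGen]
    rw [h]
    simp only [Function.comp, map_commutatorElement, aGen, bGen, alphaGen,
      FreeGroup.lift_apply_of, hGen, Fin.val_zero, if_true, mul_one]
    rw [hShear_hTrans, zpow_neg, hShift_zpow, mul_inv_cancel]

/-- For every integer `g ≥ 1` and every integer `k`, the generator `α` has
infinite order in the circle-bundle group `G_{g,k}`. -/
theorem alpha_infinite_order (g : ℕ) (hg : 1 ≤ g) (k : ℤ) :
    ¬ IsOfFinOrder (alphaElt g k) := by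
  intro h
  have h2 := (PresentedGroup.toGroup (hGen_rels g hg k)).isOfFinOrder h
  rw [alphaElt, PresentedGroup.toGroup.of, isOfFinOrder_iff_pow_eq_one] at h2
  obtain ⟨n, hn, h3⟩ := h2
  have h4 : hShift 1 ^ n = 1 := h3
  rw [hShift_npow] at h4
  have h5 := congrArg (fun e : Equiv.Perm (ℤ × ℤ) => (e (0, 0)).2) h4
  simp [hShift] at h5
  omega
end

section
/- Let g ≥ 2 be an integer, let H be a group, and let φ : ℤ × H → Γ_g be a surjective group homomorphism whose kernel is isomorphic to ℤ × ℤ. Then there exists a normal subgroup N of H with N isomorphic to ℤ and H/N isomorphic to Γ_g. (This is the extraction of the short exact sequence 0 → ⟨b⟩ → π₁(M) → π₁(B) → 1 from the homotopy sequence 0 → π₁(T²) → π₁(S¹ × M) → π₁(B) → 1 of a torus bundle over a surface B of genus at least 2.) -/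
open scoped commutatorElement

open HNNExtension HNNExtension.NormalWord in
theorem aux_hnn_center {G : Type*} [Group G] {A B : Subgroup G} (φ : A ≃* B)
    (hA : A ≠ ⊤) (hB : B ≠ ⊤) (z : HNNExtension G A B φ) (hz : ∀ x, x * z = z * x) :
    z ∈ (HNNExtension.of : G →* HNNExtension G A B φ).range := by
  obtain ⟨d⟩ := TransversalPair.nonempty G A B
  have hw : ((z • (NormalWord.empty : NormalWord d)).toReducedWord).prod φ = z := by
    simp
  generalize (z • (NormalWord.empty : NormalWord d)).toReducedWord = w at hw
  obtain ⟨h, L, hL⟩ := w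
  rcases List.eq_nil_or_concat L with rfl | ⟨l, ⟨u', g'⟩, rfl⟩
  · exact ⟨h, by simpa [ReducedWord.prod] using hw⟩
  · exfalso
    have key : ∀ g : G, ∀ u ∈ ((l.concat (u', g')).head?.map Prod.fst),
        (g * h)⁻¹ * h ∈ toSubgroup A B (-u) := by
      intro g
      let w₁ : ReducedWord G A B := ⟨g * h, _, hL⟩
      let w₂ : ReducedWord G A B := ⟨h, l.concat (u', g' * g), by
        rw [List.concat_eq_append, List.isChain_append] at hL ⊢
        refine ⟨hL.1, by simp, ?_⟩
        have := hL.2.2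
        simpa using this⟩
      refine (ReducedWord.map_fst_eq_and_of_prod_eq φ (w₁ := w₁) (w₂ := w₂) ?_).2
      have h1 : w₁.prod φ = HNNExtension.of g * z := by
        rw [← hw]; simp [w₁, ReducedWord.prod, mul_assoc]
      have h2 : w₂.prod φ = z * HNNExtension.of g := by
        rw [← hw]; simp [w₂, ReducedWord.prod, mul_assoc]
      rw [h1, h2, hz]
    obtain ⟨u, hu⟩ : ∃ u, u ∈ ((l.concat (u', g')).head?.map Prod.fst) := by
      cases l <;> simp
    have htop : toSubgroup A B (-u) = ⊤ := by
      rw [eq_top_iff]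
      intro x _
      have := key (h * x⁻¹ * h⁻¹) u hu
      simpa [mul_assoc] using this
    rcases Int.units_eq_one_or u with rfl | rfl
    · exact hB (by simpa using htop)
    · exact hA (by simpa using htop)

theorem aux_free_center {α : Type*} (x₀ y₀ : α) (hxy : x₀ ≠ y₀) (z : FreeGroup α)
    (hz : ∀ x, x * z = z * x) : z = 1 := by
  classical
  have hr : FreeGroup.IsReduced z.toWord := FreeGroup.isReduced_toWord
  by_contra hne
  have hne' : z.toWord ≠ [] := by simpa using hne
  have hmk : FreeGroup.mk z.toWord = z := FreeGroup.mk_toWord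
  generalize z.toWord = L at *
  obtain ⟨p, l, rfl⟩ := List.exists_cons_of_ne_nil hne'
  obtain ⟨x, hx⟩ : ∃ x, x ≠ p.1 := by
    by_cases h : x₀ = p.1
    · exact ⟨y₀, fun h' => hxy (h.trans h'.symm)⟩
    · exact ⟨x₀, h⟩
  set c : Bool := ((p :: l).getLast (by simp)).2 with hc
  have e := hz (FreeGroup.mk [(x, c)])
  rw [← hmk, FreeGroup.mul_mk, FreeGroup.mul_mk] at e
  have r1 : FreeGroup.IsReduced ([(x, c)] ++ p :: l) := by
    rw [List.singleton_append, FreeGroup.isReduced_cons_cons]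
    exact ⟨fun h => absurd h hx, hr⟩
  have r2 : FreeGroup.IsReduced (p :: l ++ [(x, c)]) := by
    unfold FreeGroup.IsReduced at hr ⊢
    rw [List.isChain_append]
    refine ⟨hr, by simp, ?_⟩
    intro a ha b hb
    rw [List.getLast?_eq_some_getLast (by simp)] at ha
    simp at ha hb
    subst hb
    intro _
    rw [hc, ← ha]
  have e2 := congrArg FreeGroup.toWord e
  rw [FreeGroup.toWord_mk, FreeGroup.toWord_mk, r1.reduce_eq, r2.reduce_eq] at e2
  simp at e2
  exact hx (by rw [← e2.1])

theorem aux_free_zpowers {α : Type*} (x₀ y₀ : α) (hxy : x₀ ≠ y₀) (z : FreeGroup α) :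
    Subgroup.zpowers z ≠ ⊤ := by
  intro h
  have : FreeGroup.of x₀ = 1 := by
    refine aux_free_center x₀ y₀ hxy _ fun x => ?_
    have h1 : x ∈ Subgroup.zpowers z := h ▸ Subgroup.mem_top _
    have h2 : FreeGroup.of x₀ ∈ Subgroup.zpowers z := h ▸ Subgroup.mem_top _
    obtain ⟨m, rfl⟩ := h1
    obtain ⟨n, hn⟩ := h2
    simp only at hn ⊢
    rw [← hn]
    exact ((Commute.refl z).zpow_zpow m n).eq
  exact FreeGroup.of_ne_one _ this

theorem aux_surface_center (n : ℕ) (z : SurfaceGroup (n + 2)) (hz : ∀ x, x * z = z * x) :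
    z = 1 := by
  classical
  let S := {x : Fin (n + 2) ⊕ Fin (n + 2) // x ≠ Sum.inl 0}
  let c : S := ⟨Sum.inr 0, by simp⟩
  let c' : S := ⟨Sum.inr 1, by simp⟩
  have hcc : c ≠ c' := by
    intro h
    have := congrArg Subtype.val h
    simp [c, c'] at this
  let w : FreeGroup S := (List.ofFn fun i : Fin (n + 1) =>
    ⁅(FreeGroup.of (⟨Sum.inl i.succ, by simp [Fin.succ_ne_zero]⟩ : S)),
      FreeGroup.of (⟨Sum.inr i.succ, by simp⟩ : S)⁆).prod
  let b : FreeGroup S := FreeGroup.of c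
  let v : FreeGroup S := w⁻¹ * b
  let ε : FreeGroup S →* Multiplicative ℤ :=
    FreeGroup.lift fun s => if s = c then Multiplicative.ofAdd 1 else 1
  have hεb : ε b = Multiplicative.ofAdd 1 := by simp [ε, b]
  have hεw : ε w = 1 := by
    simp only [w, map_list_prod, List.map_ofFn]
    apply List.prod_eq_one
    intro x hx
    rw [List.mem_ofFn] at hx
    obtain ⟨i, rfl⟩ := hx
    simp only [Function.comp, map_commutatorElement]
    exact commutatorElement_eq_one_iff_commute.2 (Commute.all _ _)
  have hεv : ε v = Multiplicative.ofAdd 1 := by simp [v, hεw, hεb]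
  have hord : ∀ y : FreeGroup S, ε y = Multiplicative.ofAdd 1 → orderOf y = 0 := by
    intro y hy
    rw [orderOf_eq_zero_iff']
    intro k hk h
    have := congrArg ε h
    rw [map_pow, hy, map_one ε, ← ofAdd_nsmul, ofAdd_eq_one] at this
    simp at this
    omega
  let A := Subgroup.zpowers b
  let B := Subgroup.zpowers v
  let gb : A := ⟨b, Subgroup.mem_zpowers b⟩
  let gv : B := ⟨v, Subgroup.mem_zpowers v⟩
  have hgb : ∀ x : A, x ∈ Subgroup.zpowers gb := by
    rintro ⟨x, k, rfl⟩
    exact ⟨k, by ext; simp [gb]⟩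
  have hgv : ∀ x : B, x ∈ Subgroup.zpowers gv := by
    rintro ⟨x, k, rfl⟩
    exact ⟨k, by ext; simp [gv]⟩
  let ψ : A ≃* B := mulEquivOfOrderOfEq hgb hgv (by
    rw [← Subgroup.orderOf_coe, ← Subgroup.orderOf_coe, hord _ hεb, hord _ hεv])
  have hψ : ψ gb = gv := mulEquivOfOrderOfEq_apply_gen hgb hgv _
  let E := HNNExtension (FreeGroup S) A B ψ
  have hrelE : (HNNExtension.t : E) * HNNExtension.of b
      = (HNNExtension.of v : E) * HNNExtension.t := by
    have := HNNExtension.t_mul_of (φ := ψ) gb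
    rwa [hψ] at this
  let f₀ : Fin (n + 2) ⊕ Fin (n + 2) → E := fun x =>
    if h : x = Sum.inl 0 then HNNExtension.t else HNNExtension.of (FreeGroup.of ⟨x, h⟩)
  have hf₀ : ∀ s : S, f₀ s.1 = HNNExtension.of (FreeGroup.of s) := by
    intro s
    simp only [f₀]
    rw [dif_neg s.2]
  have hf₀t : f₀ (Sum.inl 0) = HNNExtension.t := by simp [f₀]
  have hf₀w : (FreeGroup.lift f₀) (surfaceRel (n + 2)) = 1 := by
    have hw : (HNNExtension.of w : E) = (List.ofFn fun i : Fin (n + 1) =>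
        ⁅f₀ (Sum.inl i.succ), f₀ (Sum.inr i.succ)⁆).prod := by
      simp only [w, map_list_prod, List.map_ofFn, Function.comp_def, map_commutatorElement]
      congr 2
    have hb : f₀ (Sum.inr 0) = HNNExtension.of b := hf₀ c
    unfold surfaceRel
    rw [List.ofFn_succ, List.prod_cons, map_mul, map_list_prod, List.map_ofFn]
    simp only [Function.comp_def, map_commutatorElement, FreeGroup.lift_apply_of]
    rw [← hw, hf₀t, hb, commutatorElement_def, hrelE]
    simp [v]
  let f : SurfaceGroup (n + 2) →* E := PresentedGroup.toGroup (f := f₀) (by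
    rintro r rfl
    exact hf₀w)
  let k₀ : FreeGroup S →* SurfaceGroup (n + 2) :=
    FreeGroup.lift fun s => PresentedGroup.of s.1
  let a : SurfaceGroup (n + 2) := PresentedGroup.of (Sum.inl 0)
  have hab : SemiconjBy a (k₀ b) (k₀ v) := by
    have h1 : PresentedGroup.mk {surfaceRel (n + 2)} (surfaceRel (n + 2)) = 1 :=
      PresentedGroup.one_of_mem rfl
    have hb : k₀ b = PresentedGroup.of (Sum.inr 0) := by simp [k₀, b, c]
    have hw : k₀ w = (List.ofFn fun i : Fin (n + 1) =>
        ⁅(PresentedGroup.of (Sum.inl i.succ) : SurfaceGroup (n + 2)),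
          PresentedGroup.of (Sum.inr i.succ)⁆).prod := by
      simp only [w, map_list_prod, List.map_ofFn, Function.comp_def, map_commutatorElement]
      simp [k₀]
    conv at h1 =>
      lhs
      rhs
      unfold surfaceRel
    rw [List.ofFn_succ, List.prod_cons, map_mul, map_list_prod, List.map_ofFn] at h1
    simp only [Function.comp_def, map_commutatorElement] at h1
    change ⁅a, PresentedGroup.of (Sum.inr 0)⁆ * (List.ofFn fun i : Fin (n + 1) =>
        ⁅(PresentedGroup.of (Sum.inl i.succ) : SurfaceGroup (n + 2)),
          PresentedGroup.of (Sum.inr i.succ)⁆).prod = 1 at h1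
    rw [← hw, ← hb, mul_eq_one_iff_eq_inv, commutatorElement_def] at h1
    unfold SemiconjBy
    rw [show k₀ v = (k₀ w)⁻¹ * k₀ b by simp [v], ← h1]
    group
  let k : E →* SurfaceGroup (n + 2) := HNNExtension.lift k₀ a (by
    intro x
    obtain ⟨m, rfl⟩ := hgb x
    simp only [map_zpow, hψ, SubgroupClass.coe_zpow]
    exact (hab.zpow_right m).eq)
  have hkt : k HNNExtension.t = a := HNNExtension.lift_t _ _ _
  have hko : ∀ y, k (HNNExtension.of y) = k₀ y := fun y => HNNExtension.lift_of _ _ _ y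
  have hk₀ : ∀ s : S, k₀ (FreeGroup.of s) = PresentedGroup.of s.1 := fun s => by simp [k₀]
  have hfo : ∀ x, f (PresentedGroup.of x) = f₀ x := fun x => by simp [f]
  have hkf : ∀ x, k (f x) = x := by
    intro x
    have : k.comp f = MonoidHom.id _ := by
      apply PresentedGroup.ext
      intro x
      rw [MonoidHom.comp_apply, MonoidHom.id_apply, hfo]
      by_cases hx : x = Sum.inl 0
      · subst hx
        rw [hf₀t, hkt]
      · rw [hf₀ ⟨x, hx⟩, hko, hk₀]
    exact DFunLike.congr_fun this x
  have hfk : ∀ x, f (k x) = x := by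
    intro x
    have : f.comp k = MonoidHom.id _ := by
      apply HNNExtension.hom_ext
      · apply FreeGroup.ext_hom
        intro s
        change f (k (HNNExtension.of (FreeGroup.of s))) = HNNExtension.of (FreeGroup.of s)
        rw [hko, hk₀, hfo, hf₀]
      · change f (k HNNExtension.t) = HNNExtension.t
        rw [hkt, hfo, hf₀t]
    exact DFunLike.congr_fun this x
  have hcen : ∀ x, x * f z = f z * x := by
    intro x
    rw [← hfk x, ← map_mul, hz, map_mul]
  obtain ⟨y, hy⟩ := aux_hnn_center ψ (aux_free_zpowers c c' hcc b) (aux_free_zpowers c c' hcc v)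
    (f z) hcen
  have hy1 : y = 1 := by
    refine aux_free_center c c' hcc y fun x => ?_
    apply HNNExtension.of_injective (φ := ψ)
    rw [map_mul, map_mul, hy, hcen]
  rw [← hkf z, ← hy, hy1, map_one, map_one]

theorem aux_rank_one {M : Type*} [AddCommGroup M] (e : (ℤ × M) ≃+ (ℤ × ℤ)) :
    Nonempty (M ≃+ ℤ) := by
  let e' : (ℤ × M) ≃ₗ[ℤ] (ℤ × ℤ) := e.toIntLinearEquiv
  let j : M →ₗ[ℤ] (ℤ × ℤ) := e'.toLinearMap.comp (LinearMap.inr ℤ ℤ M)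
  have hj : Function.Injective j := e'.injective.comp LinearMap.inr_injective
  have : Module.Finite ℤ M := Module.Finite.of_injective j hj
  have : Module.IsTorsionFree ℤ M := hj.moduleIsTorsionFree j (fun r x => map_smul j r x)
  have : Module.Free ℤ M := inferInstance
  have h := e'.finrank_eq
  rw [Module.finrank_prod, Module.finrank_prod, Module.finrank_self] at h
  have h2 : Module.finrank ℤ M = Module.finrank ℤ ℤ := by
    rw [Module.finrank_self]; omega
  exact ⟨(LinearEquiv.ofFinrankEq M ℤ h2).toAddEquiv⟩

/-- Let `g ≥ 2`, let `H` be a group, and let `φ : ℤ × H → Γ_g` be a surjective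
group homomorphism whose kernel is isomorphic to `ℤ × ℤ`. Then there exists a normal subgroup
`N` of `H` with `N` isomorphic to `ℤ` and `H/N` isomorphic to `Γ_g`. -/
theorem exists_circle_bundle_structure (g : ℕ) (hg : 2 ≤ g) {H : Type} [Group H]
    (φ : Multiplicative ℤ × H →* SurfaceGroup g) (hsurj : Function.Surjective φ)
    (hker : Nonempty (φ.ker ≃* Multiplicative (ℤ × ℤ))) :
    ∃ (N : Subgroup H) (hN : N.Normal),
      Nonempty (N ≃* Multiplicative ℤ) ∧
      Nonempty (letI := hN; ((H ⧸ N) ≃* SurfaceGroup g)) := by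
  obtain ⟨n, rfl⟩ : ∃ n, g = n + 2 := ⟨g - 2, by omega⟩
  have hZ : ∀ t : Multiplicative ℤ, φ (t, 1) = 1 := by
    intro t
    apply aux_surface_center
    intro x
    obtain ⟨⟨s, y⟩, rfl⟩ := hsurj x
    rw [← map_mul, ← map_mul]
    simp [mul_comm]
  let ρ : H →* SurfaceGroup (n + 2) := φ.comp (MonoidHom.inr _ _)
  have hφρ : ∀ t y, φ (t, y) = ρ y := by
    intro t y
    have : ((t, y) : Multiplicative ℤ × H) = (t, 1) * (1, y) := by simp
    rw [this, map_mul, hZ, one_mul]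
    rfl
  have hρ : Function.Surjective ρ := by
    intro x
    obtain ⟨⟨s, y⟩, rfl⟩ := hsurj x
    exact ⟨y, (hφρ s y).symm⟩
  obtain ⟨e⟩ := hker
  refine ⟨ρ.ker, inferInstance, ?_, ⟨QuotientGroup.quotientKerEquivOfSurjective ρ hρ⟩⟩
  let q : (Multiplicative ℤ × ρ.ker) ≃* φ.ker :=
    { toFun := fun x => ⟨(x.1, x.2.1), by
        rw [MonoidHom.mem_ker, hφρ]; exact x.2.2⟩
      invFun := fun x => (x.1.1, ⟨x.1.2, by
        rw [MonoidHom.mem_ker, ← hφρ x.1.1]; exact x.2⟩)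
      left_inv := fun x => rfl
      right_inv := fun x => rfl
      map_mul' := fun x y => rfl }
  let r := q.trans e
  letI : CommGroup ρ.ker :=
    { (inferInstance : Group ρ.ker) with
      mul_comm := fun x y => by
        have h : r ((1, x) * (1, y)) = r ((1, y) * (1, x)) := by
          rw [map_mul, map_mul, mul_comm]
        have := congrArg Prod.snd (r.injective h)
        exact this }
  let s : (ℤ × Additive ρ.ker) ≃+ (ℤ × ℤ) :=
    { toFun := fun x => (r (Multiplicative.ofAdd x.1, x.2.toMul)).toAdd
      invFun := fun x => ((r.symm (Multiplicative.ofAdd x)).1.toAdd,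
        Additive.ofMul (r.symm (Multiplicative.ofAdd x)).2)
      left_inv := fun x => by simp
      right_inv := fun x => by simp
      map_add' := fun x y => by
        rw [← toAdd_mul, ← map_mul]
        rfl }
  obtain ⟨m⟩ := aux_rank_one s
  exact ⟨
    { toFun := fun x => Multiplicative.ofAdd (m (Additive.ofMul x))
      invFun := fun x => (m.symm x.toAdd).toMul
      left_inv := fun x => by simp
      right_inv := fun x => by simp
      map_mul' := fun x y => by
        rw [← ofAdd_add, ← map_add]
        rfl }⟩
end

section
/- For every integer g ≥ 2 and every integer k, the circle-bundle group G_{g,k} is not isomorphic to any semidirect product (ℤ × ℤ) ⋊_φ ℤ, for any action φ : ℤ → Aut(ℤ × ℤ). (This is the group-theoretic content of the statement that the total space of a circle bundle over a closed orientable surface of genus g ≥ 2 is not a torus bundle over the circle, since its first Betti number is at least 2g ≥ 4 > 3.) -/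
open scoped commutatorElement

/-- Homomorphism to `ZMod 2` with prescribed values on `a_i`, `b_i`, trivial on `α`. -/
noncomputable def circleHom (g : ℕ) (k : ℤ) (v : Fin g ⊕ Fin g → Multiplicative (ZMod 2)) :
    CircleBundleGroup g k →* Multiplicative (ZMod 2) :=
  PresentedGroup.toGroup (f := Sum.elim v (fun _ => 1)) (by
    rintro r (⟨i, rfl⟩ | ⟨i, rfl⟩ | rfl)
    · rw [map_commutatorElement, commutatorElement_eq_one_iff_mul_comm, mul_comm]
    · rw [map_commutatorElement, commutatorElement_eq_one_iff_mul_comm, mul_comm]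
    · rw [map_mul, map_zpow, map_list_prod]
      have h1 : FreeGroup.lift (Sum.elim v (fun _ => 1)) (alphaGen g) = 1 := by
        simp [alphaGen]
      rw [h1, one_zpow, mul_one]
      apply List.prod_eq_one
      intro x hx
      rw [List.mem_map] at hx
      obtain ⟨y, hy, rfl⟩ := hx
      rw [List.mem_ofFn] at hy
      obtain ⟨i, rfl⟩ := hy
      rw [map_commutatorElement, commutatorElement_eq_one_iff_mul_comm, mul_comm])

theorem circleHom_of (g : ℕ) (k : ℤ) (v : Fin g ⊕ Fin g → Multiplicative (ZMod 2))
    (x : Fin g ⊕ Fin g) : circleHom g k v (PresentedGroup.of (Sum.inl x)) = v x := by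
  simp [circleHom]

theorem semidirect_hom_ext (φ : Multiplicative ℤ →* MulAut (Multiplicative (ℤ × ℤ)))
    (f h : Multiplicative (ℤ × ℤ) ⋊[φ] Multiplicative ℤ →* Multiplicative (ZMod 2))
    (h1 : f (SemidirectProduct.inl (Multiplicative.ofAdd (1, 0))) =
      h (SemidirectProduct.inl (Multiplicative.ofAdd (1, 0))))
    (h2 : f (SemidirectProduct.inl (Multiplicative.ofAdd (0, 1))) =
      h (SemidirectProduct.inl (Multiplicative.ofAdd (0, 1))))
    (h3 : f (SemidirectProduct.inr (Multiplicative.ofAdd 1)) =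
      h (SemidirectProduct.inr (Multiplicative.ofAdd 1))) : f = h := by
  apply SemidirectProduct.hom_ext
  · ext x
    obtain ⟨m, n⟩ := x
    have : (Multiplicative.ofAdd ((m, n) : ℤ × ℤ)) =
        (Multiplicative.ofAdd ((1, 0) : ℤ × ℤ)) ^ m * (Multiplicative.ofAdd ((0, 1) : ℤ × ℤ)) ^ n := by
      rw [← ofAdd_zsmul, ← ofAdd_zsmul, ← ofAdd_add]
      simp
    change f (SemidirectProduct.inl (Multiplicative.ofAdd (m, n))) =
      h (SemidirectProduct.inl (Multiplicative.ofAdd (m, n)))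
    rw [this]
    simp only [map_mul, map_zpow, h1, h2]
  · apply MonoidHom.ext_mint
    exact h3

/-- For every integer `g ≥ 2` and every integer `k`, the circle-bundle group
`G_{g,k}` is not isomorphic to any semidirect product `(ℤ × ℤ) ⋊[φ] ℤ`, for any action
`φ : ℤ → Aut(ℤ × ℤ)`. -/
theorem circleBundleGroup_not_torusBundleGroup (g : ℕ) (hg : 2 ≤ g) (k : ℤ)
    (φ : Multiplicative ℤ →* MulAut (Multiplicative (ℤ × ℤ))) :
    ¬ Nonempty (CircleBundleGroup g k ≃* Multiplicative (ℤ × ℤ) ⋊[φ] Multiplicative ℤ) := by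
  rintro ⟨e⟩
  let F : (Fin g ⊕ Fin g → Multiplicative (ZMod 2)) →
      Multiplicative (ZMod 2) × Multiplicative (ZMod 2) × Multiplicative (ZMod 2) := fun v =>
    (circleHom g k v (e.symm (SemidirectProduct.inl (Multiplicative.ofAdd (1, 0)))),
     circleHom g k v (e.symm (SemidirectProduct.inl (Multiplicative.ofAdd (0, 1)))),
     circleHom g k v (e.symm (SemidirectProduct.inr (Multiplicative.ofAdd 1))))
  have hF : Function.Injective F := by
    intro v w hvw
    simp only [F, Prod.mk.injEq] at hvw
    obtain ⟨h1, h2, h3⟩ := hvw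
    have key := semidirect_hom_ext φ ((circleHom g k v).comp e.symm.toMonoidHom)
      ((circleHom g k w).comp e.symm.toMonoidHom) h1 h2 h3
    funext x
    have := DFunLike.congr_fun key (e (PresentedGroup.of (Sum.inl x)))
    simpa [circleHom_of] using this
  have hc := Nat.card_le_card_of_injective F hF
  have h2 : Nat.card (Multiplicative (ZMod 2)) = 2 := by
    rw [Nat.card_congr Multiplicative.toAdd, Nat.card_zmod]
  rw [Nat.card_fun, Nat.card_prod, Nat.card_prod, h2, Nat.card_sum, Nat.card_fin] at hc
  have : 2 ^ 4 ≤ 2 ^ (g + g) := Nat.pow_le_pow_right (by norm_num) (by omega)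
  omega
end
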